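/- arXiv:0802.0289 — 10 statements merged into one kernel-verified Lean document; each statement's English description precedes it below -/
import Mathlib

section
/- Let E be a real inner product space with norm ‖·‖. Then for every real number r ≥ 0 and all vectors a, b ∈ E, one has ⟨‖a‖^r · a − ‖b‖^r · b, a − b⟩ ≥ 2^{−r} · ‖a − b‖^{r+2}. -/
open Real
open scoped RealInnerProductSpace

/-- Midpoint convexity of `x ↦ x ^ (r + 1)` on the nonnegative reals. -/
theorem two_rpow_neg_mul_add_rpow_mul_le {r A B : ℝ} (hr : 0 ≤ r) (hA : 0 ≤ A) (hB : 0 ≤ B) :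
    (2 : ℝ) ^ (-r) * ((A + B) ^ r * (A + B)) ≤ A ^ r * A + B ^ r * B := by
  have h : (A + B) ^ (r + 1) ≤ 2 ^ r * (A ^ (r + 1) + B ^ (r + 1)) := by
    have := NNReal.rpow_add_le_mul_rpow_add_rpow ⟨A, hA⟩ ⟨B, hB⟩ (p := r + 1) (by linarith)
    rw [add_sub_cancel_right] at this
    exact_mod_cast this
  have e : ∀ {x : ℝ}, 0 ≤ x → x ^ (r + 1) = x ^ r * x := fun hx => by
    rw [rpow_add_of_nonneg hx hr zero_le_one, rpow_one]
  rw [e (add_nonneg hA hB), e hA, e hB] at h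
  rw [rpow_neg zero_le_two, inv_mul_le_iff₀ (by positivity)]
  exact h

theorem inner_smul_sub_smul_sub {E : Type*} [NormedAddCommGroup E] [InnerProductSpace ℝ E]
    (s t : ℝ) (a b : E) :
    2 * ⟪s • a - t • b, a - b⟫ =
      (s + t) * ‖a - b‖ ^ 2 + (s - t) * (‖a‖ - ‖b‖) * (‖a‖ + ‖b‖) := by
  rw [norm_sub_sq_real]
  simp only [inner_sub_left, inner_sub_right, real_inner_smul_left, real_inner_self_eq_norm_sq,
    real_inner_comm a b]
  ring

theorem lemma_3_1 {E : Type*} [NormedAddCommGroup E] [InnerProductSpace ℝ E]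
    (r : ℝ) (hr : 0 ≤ r) (a b : E) :
    ⟪(‖a‖ ^ r) • a - (‖b‖ ^ r) • b, a - b⟫ ≥ (2 : ℝ) ^ (-r) * ‖a - b‖ ^ (r + 2) := by
  have hA := norm_nonneg a
  have hB := norm_nonneg b
  have hD := norm_nonneg (a - b)
  have hDS := norm_sub_le a b
  have hI := inner_smul_sub_smul_sub (‖a‖ ^ r) (‖b‖ ^ r) a b
  have hK := two_rpow_neg_mul_add_rpow_mul_le hr hA hB
  have hP : 0 ≤ (‖a‖ ^ r - ‖b‖ ^ r) * (‖a‖ - ‖b‖) := by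
    rcases le_total ‖a‖ ‖b‖ with h | h
    · exact mul_nonneg_of_nonpos_of_nonpos (sub_nonpos.2 (rpow_le_rpow hA h hr))
        (sub_nonpos.2 h)
    · exact mul_nonneg (sub_nonneg.2 (rpow_le_rpow hB h hr)) (sub_nonneg.2 h)
  have hR : ‖a - b‖ ^ (r + 2) = ‖a - b‖ ^ r * ‖a - b‖ ^ 2 := by
    rw [rpow_add_of_nonneg hD hr zero_le_two, rpow_two]
  rw [hR]
  rcases hD.eq_or_lt with h0 | hpos
  · rw [← h0, sub_eq_zero.1 (norm_eq_zero.1 h0.symm)]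
    simp
  have hS : 0 < ‖a‖ + ‖b‖ := hpos.trans_le hDS
  have hmono : (2 : ℝ) ^ (-r) * ‖a - b‖ ^ r ≤ 2 ^ (-r) * (‖a‖ + ‖b‖) ^ r := by gcongr
  have hsq : ‖a - b‖ ^ 2 ≤ (‖a‖ + ‖b‖) ^ 2 := by gcongr
  generalize ⟪(‖a‖ ^ r) • a - (‖b‖ ^ r) • b, a - b⟫ = I at *
  generalize ‖a‖ ^ r = s at *
  generalize ‖b‖ ^ r = t at *
  generalize (‖a‖ + ‖b‖) ^ r = u at *
  generalize ‖a - b‖ ^ r = v at *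
  generalize (2 : ℝ) ^ (-r) = w at *
  have hv := mul_le_mul_of_nonneg_right hmono (mul_nonneg (sq_nonneg ‖a - b‖) hS.le)
  have hu := mul_le_mul_of_nonneg_right hK (sq_nonneg ‖a - b‖)
  have hp := mul_le_mul_of_nonneg_left hsq hP
  refine le_of_mul_le_mul_right ?_ hS
  linear_combination hv + hu + hp / 2 - (‖a‖ + ‖b‖) / 2 * hI
end

section
/- Let E be a real inner product space with norm ‖·‖. Then for every real number r ≥ 0 and all vectors a, b ∈ E, one has ⟨‖a‖^r · a − ‖b‖^r · b, a − b⟩ ≥ (1/2)(‖a‖^r + ‖b‖^r) · ‖a − b‖^2. -/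
open Real
open scoped RealInnerProductSpace

theorem lemma_3_1_intermediate {E : Type*} [NormedAddCommGroup E] [InnerProductSpace ℝ E]
    (r : ℝ) (hr : 0 ≤ r) (a b : E) :
    ⟪(‖a‖ ^ r) • a - (‖b‖ ^ r) • b, a - b⟫
      ≥ (1 / 2) * (‖a‖ ^ r + ‖b‖ ^ r) * ‖a - b‖ ^ (2 : ℝ) := by
  have h : 0 ≤ (‖a‖ ^ r - ‖b‖ ^ r) * (‖a‖ ^ 2 - ‖b‖ ^ 2) := by
    rcases le_total ‖a‖ ‖b‖ with hab | hab
    · exact mul_nonneg_of_nonpos_of_nonpos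
        (sub_nonpos.2 (rpow_le_rpow (norm_nonneg a) hab hr))
        (sub_nonpos.2 (pow_le_pow_left₀ (norm_nonneg a) hab 2))
    · exact mul_nonneg
        (sub_nonneg.2 (rpow_le_rpow (norm_nonneg b) hab hr))
        (sub_nonneg.2 (pow_le_pow_left₀ (norm_nonneg b) hab 2))
  rw [rpow_two, norm_sub_sq_real]
  simp only [inner_sub_left, inner_sub_right, real_inner_smul_left, real_inner_self_eq_norm_sq,
    real_inner_comm a b]
  linarith
end

section
/- Let T > 0, ε ∈ (0,1), and let γ, β : [0,T] → ℝ be continuous with β ≥ 0. Let ψ : [0,T] → [0,∞) be continuous, and suppose ψ is absorbed at zero, i.e., if ψ(t₀) = 0 for some t₀ ∈ [0,T] then ψ(t) = 0 for all t ∈ [t₀, T]. Set τ := inf{t ∈ [0,T] : ψ(t) = 0} (with τ = T if ψ > 0 on [0,T]). Assume that for every t ∈ [0, τ], e^{−(ε/2)∫₀^t γ(s) ds} ψ(t)^ε ≤ ψ(0)^ε − (ε/2) ∫₀^t β(s) e^{−(ε/2)∫₀^s γ(u) du} ds. If ∫₀^T β(t) e^{−(ε/2)∫₀^t γ(s) ds}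 dt ≥ (2/ε) ψ(0)^ε, then ψ(T) = 0. -/
open Real Set
open scoped Classical

theorem coupling_time_lemma
    (T : ℝ) (hT : 0 < T) (ε : ℝ) (hε : ε ∈ Set.Ioo (0 : ℝ) 1)
    (γ β ψ : ℝ → ℝ)
    (hγ : ContinuousOn γ (Set.Icc 0 T))
    (hβcont : ContinuousOn β (Set.Icc 0 T))
    (hβ : ∀ t ∈ Set.Icc (0 : ℝ) T, 0 ≤ β t)
    (hψcont : ContinuousOn ψ (Set.Icc 0 T))
    (hψ : ∀ t ∈ Set.Icc (0 : ℝ) T, 0 ≤ ψ t)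
    (habs : ∀ t₀ ∈ Set.Icc (0 : ℝ) T, ψ t₀ = 0 → ∀ t ∈ Set.Icc t₀ T, ψ t = 0)
    (τ : ℝ)
    (hτ : τ = if ∃ t ∈ Set.Icc (0 : ℝ) T, ψ t = 0
              then sInf {t | t ∈ Set.Icc (0 : ℝ) T ∧ ψ t = 0} else T)
    (hineq : ∀ t ∈ Set.Icc (0 : ℝ) τ,
      Real.exp (-(ε / 2) * ∫ s in (0 : ℝ)..t, γ s) * (ψ t) ^ ε
        ≤ (ψ 0) ^ ε - (ε / 2) *
            ∫ s in (0 : ℝ)..t, β s * Real.exp (-(ε / 2) * ∫ u in (0 : ℝ)..s, γ u))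
    (hbig : (2 / ε) * (ψ 0) ^ ε
        ≤ ∫ t in (0 : ℝ)..T, β t * Real.exp (-(ε / 2) * ∫ s in (0 : ℝ)..t, γ s)) :
    ψ T = 0 := by
  by_cases h : ∃ t ∈ Set.Icc (0 : ℝ) T, ψ t = 0
  · obtain ⟨t, ht, ht0⟩ := h
    exact habs t ht ht0 T ⟨ht.2, le_rfl⟩
  · rw [if_neg h] at hτ
    subst hτ
    have hε0 : 0 < ε := hε.1
    have hτmem : τ ∈ Set.Icc (0 : ℝ) τ := ⟨hT.le, le_rfl⟩
    have hpos : 0 < ψ τ := (hψ τ hτmem).lt_of_ne fun h0 => h ⟨τ, hτmem, h0.symm⟩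
    have hlhs := mul_pos (Real.exp_pos (-(ε / 2) * ∫ s in (0 : ℝ)..τ, γ s))
      (Real.rpow_pos_of_pos hpos ε)
    have hscaled := mul_le_mul_of_nonneg_left hbig (half_pos hε0).le
    have hcancel : ε / 2 * (2 / ε * ψ 0 ^ ε) = ψ 0 ^ ε := by field_simp
    linarith [hineq τ hτmem]
end

section
/- Let α > 2 and c > 0, and let g : [0,∞) → [0,∞) be a continuous function such that for all 0 ≤ s ≤ t one has g(t) ≤ g(s) − c ∫ₛ^t g(u)^{α/2} du. Then for every t > 0, g(t) ≤ min( g(0), ( c·((α−2)/2)·t )^{−2/(α−2)} ). In particular, g(t) is bounded for t > 0 by a constant multiple of t^{−2/(α−2)} uniformly in the initial value g(0). -/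
open Real Set

/-- A positive function with `G' ≤ -c G ^ (1 + β)` on `[0, t]` satisfies
`c β t ≤ G t ^ (-β)`. -/
theorem mul_le_rpow_neg_of_hasDerivAt {c β t : ℝ} (hβ : 0 < β) (ht : 0 ≤ t) {G G' : ℝ → ℝ}
    (hpos : ∀ s ∈ Icc 0 t, 0 < G s) (hG : ∀ s ∈ Icc 0 t, HasDerivAt G (G' s) s)
    (hG' : ∀ s ∈ Icc 0 t, G' s ≤ -(c * G s ^ (1 + β))) :
    c * β * t ≤ G t ^ (-β) := by
  have hder : ∀ s ∈ Icc 0 t,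
      HasDerivAt (fun s => G s ^ (-β)) (G' s * (-β) * G s ^ (-β - 1)) s :=
    fun s hs => (hG s hs).rpow_const (Or.inl (hpos s hs).ne')
  have hmvt := (convex_Icc 0 t).mul_sub_le_image_sub_of_le_deriv
    (f := fun s => G s ^ (-β)) (C := c * β)
    (fun s hs => (hder s hs).continuousAt.continuousWithinAt)
    (fun s hs => (hder s (interior_subset hs)).differentiableAt.differentiableWithinAt)
    (fun s hs => by
      have hs := interior_subset hs
      rw [(hder s hs).deriv]
      have hone : G s ^ (1 + β) * G s ^ (-β - 1) = 1 := by
        rw [← rpow_add (hpos s hs), show 1 + β + (-β - 1) = 0 by ring, rpow_zero]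
      have hmul := mul_le_mul_of_nonneg_right (hG' s hs)
        (mul_nonneg hβ.le (rpow_nonneg (hpos s hs).le (-β - 1)))
      linear_combination hmul - c * β * hone)
    0 (left_mem_Icc.2 ht) t (right_mem_Icc.2 ht) ht
  have h0 := rpow_nonneg (hpos 0 (left_mem_Icc.2 ht)).le (-β)
  simp only [sub_zero] at hmvt
  linarith

theorem algebraic_decay
    (α c : ℝ) (hα : 2 < α) (hc : 0 < c)
    (g : ℝ → ℝ)
    (hgcont : ContinuousOn g (Set.Ici 0))
    (hgnonneg : ∀ t ≥ (0 : ℝ), 0 ≤ g t)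
    (hineq : ∀ s t : ℝ, 0 ≤ s → s ≤ t →
      g t ≤ g s - c * ∫ u in s..t, (g u) ^ (α / 2)) :
    ∀ t > (0 : ℝ),
      g t ≤ min (g 0) ((c * ((α - 2) / 2) * t) ^ (-(2 / (α - 2)))) := by
  intro t ht
  have hint : ∀ s ∈ Icc 0 t, 0 ≤ ∫ u in s..t, g u ^ (α / 2) := fun s hs =>
    intervalIntegral.integral_nonneg hs.2 fun u hu =>
      rpow_nonneg (hgnonneg u (hs.1.trans hu.1)) _
  refine le_min ?_ ?_
  · have := hineq 0 t le_rfl ht.le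
    have := mul_nonneg hc.le (hint 0 (left_mem_Icc.2 ht.le))
    linarith
  have hβ : 0 < (α - 2) / 2 := by linarith
  have hbase : 0 < c * ((α - 2) / 2) * t := by positivity
  rcases (hgnonneg t ht.le).eq_or_lt with h0 | hgt
  · rw [← h0]
    positivity
  set f : ℝ → ℝ := fun u => g (max u 0) ^ (α / 2) with hf
  have hfcont : Continuous f :=
    (hgcont.comp_continuous (by fun_prop) fun u => le_max_right u 0).rpow_const
      fun _ => Or.inr (by linarith)
  have hfg : ∀ s ∈ Icc 0 t, ∫ u in s..t, f u = ∫ u in s..t, g u ^ (α / 2) := by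
    intro s hs
    refine intervalIntegral.integral_congr fun u hu => ?_
    rw [uIcc_of_le hs.2] at hu
    simp only [hf, max_eq_left (hs.1.trans hu.1)]
  have hGpos : ∀ s ∈ Icc 0 t, 0 < g t + c * ∫ u in s..t, f u := by
    intro s hs
    rw [hfg s hs]
    have := mul_nonneg hc.le (hint s hs)
    linarith
  have key := mul_le_rpow_neg_of_hasDerivAt (c := c) (G := fun s => g t + c * ∫ u in s..t, f u)
    (G' := fun s => c * -f s) hβ ht.le hGpos
    (fun s _ => ((intervalIntegral.integral_hasDerivAt_left
      (hfcont.intervalIntegrable s t) hfcont.stronglyMeasurable.stronglyMeasurableAtFilter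
      hfcont.continuousAt).const_mul c).const_add (g t))
    (fun s hs => by
      have hle : g t + c * ∫ u in s..t, f u ≤ g s := by
        rw [hfg s hs]
        linarith [hineq s t hs.1 hs.2]
      have hpow := rpow_le_rpow (hGpos s hs).le hle (by linarith : 0 ≤ 1 + (α - 2) / 2)
      have hfs : f s = g s ^ (1 + (α - 2) / 2) := by
        simp only [hf, max_eq_left hs.1]
        congr 1
        ring
      rw [hfs, mul_neg]
      exact neg_le_neg (mul_le_mul_of_nonneg_left hpow hc.le))
  simp only [intervalIntegral.integral_same, mul_zero, add_zero] at key
  have hexp : -((α - 2) / 2) * -(2 / (α - 2)) = 1 := by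
    have : α - 2 ≠ 0 := by linarith
    field_simp
  calc g t = (g t ^ (-((α - 2) / 2))) ^ (-(2 / (α - 2))) := by
        rw [← rpow_mul hgt.le, hexp, rpow_one]
    _ ≤ _ := rpow_le_rpow_of_nonpos hbase key
        (neg_nonpos.2 (div_nonneg zero_le_two (by linarith)))
end

section
/- Let β > 1 and c, θ > 0. Then there exists a constant C > 0, depending only on β, c, θ, such that every differentiable function u : [0,∞) → [0,∞) satisfying u′(t) ≤ c − θ·u(t)^β for all t ≥ 0 obeys the bound u(t) ≤ C( 1 + t^{−1/(β−1)} ) for every t > 0; in particular the bound does not depend on the initial value u(0). -/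
open Real

/-- A large enough multiple of `1 + t ^ (-(1 / (β - 1)))` is a strict supersolution of
`u' = c - θ * u ^ β`. -/
lemma exists_strict_supersolution {β c θ : ℝ} (hβ : 1 < β) (hc : 0 < c) (hθ : 0 < θ) :
    ∃ C > (0 : ℝ), ∀ t > (0 : ℝ),
      c - θ * (C * (1 + t ^ (-(1 / (β - 1))))) ^ β <
        C * (-(1 / (β - 1)) * t ^ (-(1 / (β - 1)) - 1)) := by
  have hβ' : 0 < β - 1 := by linarith
  set p := 1 / (β - 1) with hp
  have hp0 : 0 < p := by positivity
  have hpβ : -p * β = -p - 1 := by rw [hp]; field_simp; ring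
  set C := max 1 (((c + p + 1) / θ) ^ p) with hC
  have hC1 : 1 ≤ C := le_max_left _ _
  have hC0 : 0 < C := by linarith
  have hCβ : C * (c + p + 1) ≤ θ * C ^ β := by
    have h : (c + p + 1) / θ ≤ C ^ (β - 1) := by
      calc (c + p + 1) / θ = (((c + p + 1) / θ) ^ p) ^ (β - 1) := by
            rw [← rpow_mul (by positivity), hp, one_div_mul_cancel hβ'.ne', rpow_one]
        _ ≤ C ^ (β - 1) := rpow_le_rpow (by positivity) (le_max_right _ _) hβ'.le
    rw [div_le_iff₀ hθ] at h
    have h' : C ^ β = C ^ (β - 1) * C := by rw [← rpow_add_one hC0.ne', sub_add_cancel]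
    rw [h']
    nlinarith
  refine ⟨C, hC0, fun t ht => ?_⟩
  have hsuper : 1 + t ^ (-p - 1) ≤ (1 + t ^ (-p)) ^ β := by
    have h := add_rpow_le_rpow_add zero_le_one (rpow_nonneg ht.le (-p)) hβ.le
    rwa [one_rpow, ← rpow_mul ht.le, hpβ] at h
  have hs : 0 < t ^ (-p - 1) := rpow_pos_of_pos ht _
  rw [mul_rpow hC0.le (by positivity), ← mul_assoc]
  have h : C * (c + p + 1) * (1 + t ^ (-p - 1)) ≤ θ * C ^ β * (1 + t ^ (-p)) ^ β := by
    gcongr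
  have hcC : c ≤ C * c := le_mul_of_one_le_left hc.le hC1
  have h₁ : 0 < C * (p + 1) := by positivity
  have h₂ : 0 < C * (c + 1) * t ^ (-p - 1) := by positivity
  linarith

theorem ode_uniform_bound
    (β c θ : ℝ) (hβ : 1 < β) (hc : 0 < c) (hθ : 0 < θ) :
    ∃ C > (0 : ℝ), ∀ u : ℝ → ℝ,
      (∀ t ≥ (0 : ℝ), 0 ≤ u t) →
      (∀ t ≥ (0 : ℝ), DifferentiableAt ℝ u t) →
      (∀ t ≥ (0 : ℝ), deriv u t ≤ c - θ * (u t) ^ β) →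
      ∀ t > (0 : ℝ), u t ≤ C * (1 + t ^ (-(1 / (β - 1)))) := by
  obtain ⟨C, hC0, hC⟩ := exists_strict_supersolution hβ hc hθ
  refine ⟨C, hC0, fun u _ hdiff hderiv t ht => ?_⟩
  have hp : -(1 / (β - 1)) < 0 := neg_lt_zero.2 (one_div_pos.2 (sub_pos.2 hβ))
  set B : ℝ → ℝ := fun s => C * (1 + s ^ (-(1 / (β - 1))))
  have hB : ∀ s > 0, HasDerivAt B (C * (-(1 / (β - 1)) * s ^ (-(1 / (β - 1)) - 1))) s :=
    fun s hs => ((hasDerivAt_rpow_const (Or.inl hs.ne')).const_add 1).const_mul C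
  obtain ⟨ε, hεB, hε0, hεt⟩ : ∃ ε, u ε ≤ B ε ∧ 0 < ε ∧ ε < t := by
    have hB_top : Filter.Tendsto B (nhdsWithin 0 (Set.Ioi 0)) Filter.atTop :=
      (Filter.tendsto_atTop_add_const_left _ 1
        (tendsto_rpow_neg_nhdsGT_zero hp)).const_mul_atTop hC0
    have hu : ∀ᶠ s in nhdsWithin 0 (Set.Ioi 0), u s < u 0 + 1 :=
      ((hdiff 0 le_rfl).continuousAt.eventually_lt_const (lt_add_one _)).filter_mono
        nhdsWithin_le_nhds
    obtain ⟨ε, h₁, h₂, h₃⟩ := (hu.and ((hB_top.eventually_ge_atTop (u 0 + 1)).and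
      (Ioo_mem_nhdsGT ht))).exists
    exact ⟨ε, h₁.le.trans h₂, h₃.1, h₃.2⟩
  have hpos : ∀ s, ε ≤ s → 0 < s := fun s hs => hε0.trans_le hs
  refine image_le_of_deriv_right_lt_deriv_boundary' (f := u) (f' := deriv u) (B := B)
    (fun s hs => (hdiff s (hpos s hs.1).le).continuousAt.continuousWithinAt)
    (fun s hs => (hdiff s (hpos s hs.1).le).hasDerivAt.hasDerivWithinAt) hεB
    (fun s hs => (hB s (hpos s hs.1)).continuousAt.continuousWithinAt)
    (fun s hs => (hB s (hpos s hs.1)).hasDerivWithinAt)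
    (fun s hs hus => ?_) (Set.right_mem_Icc.2 hεt.le)
  refine (hderiv s (hpos s hs.1).le).trans_lt ?_
  rw [hus]
  exact hC s (hpos s hs.1)
end

section
/- Let H be a real separable Hilbert space with its Borel σ-algebra, κ a Markov kernel from H to H, and μ a probability measure on H invariant for κ. Let p > 1, q := p/(p−1), C > 0, θ > 0, and let f : H → [0,∞) be measurable with ∫ f^q dμ ≤ 1. Assume the Harnack inequality: for all x, y ∈ H, (κf(x))^q ≤ (κ(f^q)(y)) · exp( pC ‖x − y‖^θ ). Then for every x ∈ H, κf(x) ≤ ( ∫_H exp( −pC ‖x − y‖^θ ) μ(dy) )^{−(p−1)/p}. -/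
open Real MeasureTheory ProbabilityTheory ENNReal

theorem harnack_semigroup_bound
    {H : Type*} [NormedAddCommGroup H] [InnerProductSpace ℝ H] [CompleteSpace H]
    [TopologicalSpace.SeparableSpace H] [MeasurableSpace H] [BorelSpace H]
    (κ : Kernel H H) [IsMarkovKernel κ]
    (μ : Measure H) [IsProbabilityMeasure μ]
    (hinv : μ.bind (fun x => κ x) = μ)
    (p C θ : ℝ) (hp : 1 < p) (hC : 0 < C) (hθ : 0 < θ)
    (q : ℝ) (hq : q = p / (p - 1))
    (f : H → ℝ) (hf : Measurable f) (hf0 : ∀ y, 0 ≤ f y)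
    (hfq : ∫⁻ y, ENNReal.ofReal ((f y) ^ q) ∂μ ≤ 1)
    (harnack : ∀ x y : H,
      (∫⁻ z, ENNReal.ofReal (f z) ∂(κ x)) ^ q
        ≤ (∫⁻ z, ENNReal.ofReal ((f z) ^ q) ∂(κ y))
            * ENNReal.ofReal (Real.exp (p * C * ‖x - y‖ ^ θ))) :
    ∀ x : H,
      (∫⁻ z, ENNReal.ofReal (f z) ∂(κ x))
        ≤ (∫⁻ y, ENNReal.ofReal (Real.exp (-(p * C) * ‖x - y‖ ^ θ)) ∂μ)
            ^ (-(p - 1) / p) := by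
  intro x
  have hp0 : 0 < p - 1 := by linarith
  have hq0 : 0 < q := by rw [hq]; exact div_pos (by linarith) hp0
  have hbound : ∀ y, (∫⁻ z, ENNReal.ofReal (f z) ∂(κ x)) ^ q
      * ENNReal.ofReal (Real.exp (-(p * C) * ‖x - y‖ ^ θ))
      ≤ ∫⁻ z, ENNReal.ofReal ((f z) ^ q) ∂(κ y) := by
    intro y
    refine (mul_le_mul_left (harnack x y) _).trans_eq ?_
    rw [mul_assoc, ← ENNReal.ofReal_mul (Real.exp_pos _).le, ← Real.exp_add, neg_mul,
      add_neg_cancel, Real.exp_zero, ENNReal.ofReal_one, mul_one]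
  have hint : (∫⁻ z, ENNReal.ofReal (f z) ∂(κ x)) ^ q
      * ∫⁻ y, ENNReal.ofReal (Real.exp (-(p * C) * ‖x - y‖ ^ θ)) ∂μ ≤ 1 :=
    calc _ ≤ ∫⁻ y, (∫⁻ z, ENNReal.ofReal (f z) ∂(κ x)) ^ q
          * ENNReal.ofReal (Real.exp (-(p * C) * ‖x - y‖ ^ θ)) ∂μ :=
          lintegral_const_mul_le _ _
      _ ≤ ∫⁻ y, ∫⁻ z, ENNReal.ofReal ((f z) ^ q) ∂(κ y) ∂μ := lintegral_mono hbound
      _ = ∫⁻ z, ENNReal.ofReal ((f z) ^ q) ∂(μ.bind fun y => κ y) :=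
          (Measure.lintegral_bind κ.measurable.aemeasurable
            (hf.pow_const q).ennreal_ofReal.aemeasurable).symm
      _ ≤ 1 := by rwa [hinv]
  have hexp : -(p - 1) / p = -q⁻¹ := by rw [hq, inv_div, neg_div]
  rw [hexp, ENNReal.rpow_neg, ← ENNReal.inv_rpow, ENNReal.le_rpow_inv_iff hq0]
  exact ENNReal.le_inv_iff_mul_le.2 hint
end

section
/- Let H be a real separable Hilbert space with its Borel σ-algebra, κ a Markov kernel from H to H, and μ a probability measure on H invariant for κ. Let p > 1, q := p/(p−1), C > 0, θ > 0, and assume the Harnack inequality: for every bounded measurable f : H → [0,∞) and all x, y ∈ H, (κf(x))^q ≤ (κ(f^q)(y)) · exp( pC ‖x − y‖^θ ). Fix x ∈ H and suppose κ(x,·) has a density with respect to μ, i.e., κ(x,·) = μ.withDensity ρ for some measurable ρ : H → [0,∞). Then ( ∫_H ρ(y)^p μ(dy) )^{1/p} ≤ ( ∫_H exp( −pC ‖x − y‖^θ ) μ(dy) )^{−(p−1)/p}. -/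
open Real MeasureTheory ProbabilityTheory ENNReal

/-- Monotone truncation: a bound on the `p`-th moments of all truncations `min (g y) n` bounds the
`p`-th moment of `g`. -/
lemma lintegral_ofReal_rpow_le_of_truncation {α : Type*} [MeasurableSpace α] {μ : Measure α}
    {g : α → ℝ} (hg : Measurable g) {p : ℝ} (hp : 0 ≤ p) {B : ℝ≥0∞}
    (h : ∀ n : ℕ, ∫⁻ y, ENNReal.ofReal (min (g y) n) ^ p ∂μ ≤ B) :
    ∫⁻ y, ENNReal.ofReal (g y) ^ p ∂μ ≤ B := by
  refine le_of_tendsto' (lintegral_tendsto_of_tendsto_of_monotone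
    (f := fun (n : ℕ) y => ENNReal.ofReal (min (g y) n) ^ p)
    (fun n => by fun_prop) (ae_of_all _ fun y m n hmn => ?_) (ae_of_all _ fun y => ?_)) h
  · dsimp only
    gcongr
  · obtain ⟨N, hN⟩ := exists_nat_ge (g y)
    refine tendsto_const_nhds.congr' ?_
    filter_upwards [Filter.eventually_ge_atTop N] with n hn
    rw [min_eq_left (hN.trans (by exact_mod_cast hn))]

/-- If `I` is finite and `I ^ q * Z ≤ I` for the exponent `q` conjugate to `p`, then
`I ≤ Z ^ (-(p - 1))`. -/
lemma ENNReal.le_rpow_neg_of_rpow_mul_le {p q : ℝ} (hp : 1 < p) (hq : q = p / (p - 1))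
    {I Z : ℝ≥0∞} (hI : I ≠ ∞) (h : I ^ q * Z ≤ I) : I ≤ Z ^ (-(p - 1)) := by
  have hp1 : 0 < p - 1 := sub_pos.2 hp
  rcases eq_or_ne I 0 with rfl | hI0
  · exact zero_le
  have hq1 : q = 1 + (p - 1)⁻¹ := by rw [hq]; field_simp; ring
  rw [hq1, ENNReal.rpow_add _ _ hI0 hI, ENNReal.rpow_one, mul_assoc] at h
  have h1 : I ^ (p - 1)⁻¹ * Z ≤ 1 :=
    (ENNReal.mul_le_mul_iff_right hI0 hI).1 (h.trans_eq (mul_one I).symm)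
  have h2 := ENNReal.rpow_le_rpow (ENNReal.le_inv_iff_mul_le.2 h1) hp1.le
  rwa [ENNReal.rpow_inv_rpow hp1.ne', ENNReal.inv_rpow, ← ENNReal.rpow_neg] at h2

theorem harnack_density_bound
    {H : Type*} [NormedAddCommGroup H] [InnerProductSpace ℝ H] [CompleteSpace H]
    [TopologicalSpace.SeparableSpace H] [MeasurableSpace H] [BorelSpace H]
    (κ : Kernel H H) [IsMarkovKernel κ]
    (μ : Measure H) [IsProbabilityMeasure μ]
    (hinv : μ.bind (fun x => κ x) = μ)
    (p C θ : ℝ) (hp : 1 < p) (hC : 0 < C) (hθ : 0 < θ)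
    (q : ℝ) (hq : q = p / (p - 1))
    (harnack : ∀ f : H → ℝ, Measurable f → (∀ y, 0 ≤ f y) → (∃ M : ℝ, ∀ y, f y ≤ M) →
      ∀ x y : H,
        (∫⁻ z, ENNReal.ofReal (f z) ∂(κ x)) ^ q
          ≤ (∫⁻ z, ENNReal.ofReal ((f z) ^ q) ∂(κ y))
              * ENNReal.ofReal (Real.exp (p * C * ‖x - y‖ ^ θ)))
    (x : H) (ρ : H → ℝ) (hρ : Measurable ρ) (hρ0 : ∀ y, 0 ≤ ρ y)
    (hdens : κ x = μ.withDensity (fun y => ENNReal.ofReal (ρ y))) :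
    (∫⁻ y, ENNReal.ofReal (ρ y) ^ p ∂μ) ^ (1 / p)
      ≤ (∫⁻ y, ENNReal.ofReal (Real.exp (-(p * C) * ‖x - y‖ ^ θ)) ∂μ)
          ^ (-(p - 1) / p) := by
  have hp0 : 0 < p := one_pos.trans hp
  have hp1 : 0 < p - 1 := sub_pos.2 hp
  set Z := ∫⁻ y, ENNReal.ofReal (Real.exp (-(p * C) * ‖x - y‖ ^ θ)) ∂μ
  suffices hmain : ∫⁻ y, ENNReal.ofReal (ρ y) ^ p ∂μ ≤ Z ^ (-(p - 1)) by
    refine (ENNReal.rpow_le_rpow hmain (by positivity)).trans_eq ?_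
    rw [← ENNReal.rpow_mul, mul_one_div]
  refine lintegral_ofReal_rpow_le_of_truncation hρ hp0.le fun n => ?_
  set g : H → ℝ := fun y => min (ρ y) n
  have hgm : Measurable g := hρ.min measurable_const
  have hg0 : ∀ y, 0 ≤ g y := fun y => le_min (hρ0 y) n.cast_nonneg
  change ∫⁻ y, ENNReal.ofReal (g y) ^ p ∂μ ≤ _
  set I := ∫⁻ y, ENNReal.ofReal (g y) ^ p ∂μ
  have hItop : I ≠ ∞ := by
    refine ((lintegral_mono (g := fun _ => ENNReal.ofReal n ^ p) fun y => ?_).trans_lt ?_).ne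
    · exact ENNReal.rpow_le_rpow (ENNReal.ofReal_le_ofReal (min_le_right _ _)) hp0.le
    · simpa using ENNReal.rpow_lt_top_of_nonneg hp0.le (ENNReal.natCast_ne_top n)
  have hIx : I ≤ ∫⁻ z, ENNReal.ofReal (g z ^ (p - 1)) ∂(κ x) := by
    rw [hdens, lintegral_withDensity_eq_lintegral_mul _ (by fun_prop) (by fun_prop)]
    refine lintegral_mono fun y => ?_
    rw [Pi.mul_apply, ← ENNReal.ofReal_mul (hρ0 y), ENNReal.ofReal_rpow_of_nonneg (hg0 y) hp0.le]
    refine ENNReal.ofReal_le_ofReal ?_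
    calc g y ^ p = g y * g y ^ (p - 1) := by
          rw [← Real.rpow_one_add' (hg0 y) (by linarith), add_sub_cancel]
      _ ≤ ρ y * g y ^ (p - 1) :=
          mul_le_mul_of_nonneg_right (min_le_left _ _) (Real.rpow_nonneg (hg0 y) _)
  have hpow : ∀ z, ENNReal.ofReal ((g z ^ (p - 1)) ^ q) = ENNReal.ofReal (g z) ^ p := fun z => by
    rw [← Real.rpow_mul (hg0 z), hq, mul_div_cancel₀ p hp1.ne',
      ENNReal.ofReal_rpow_of_nonneg (hg0 z) hp0.le]
  have hq0 : 0 ≤ q := by rw [hq]; positivity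
  have hpt : ∀ y, I ^ q * ENNReal.ofReal (Real.exp (-(p * C) * ‖x - y‖ ^ θ))
      ≤ ∫⁻ z, ENNReal.ofReal (g z) ^ p ∂(κ y) := fun y => by
    have h := harnack (fun z => g z ^ (p - 1)) (by fun_prop)
      (fun z => Real.rpow_nonneg (hg0 z) _)
      ⟨(n : ℝ) ^ (p - 1), fun z => Real.rpow_le_rpow (hg0 z) (min_le_right _ _) hp1.le⟩ x y
    simp only [hpow] at h
    calc _ ≤ _ := mul_le_mul_left ((ENNReal.rpow_le_rpow hIx hq0).trans h) _
      _ = _ := by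
        rw [mul_assoc, ← ENNReal.ofReal_mul (Real.exp_nonneg _), ← Real.exp_add, neg_mul,
          add_neg_cancel, Real.exp_zero, ENNReal.ofReal_one, mul_one]
  refine ENNReal.le_rpow_neg_of_rpow_mul_le hp hq hItop ?_
  calc I ^ q * Z = ∫⁻ y, I ^ q * ENNReal.ofReal (Real.exp (-(p * C) * ‖x - y‖ ^ θ)) ∂μ :=
        (lintegral_const_mul' _ _ (ENNReal.rpow_ne_top_of_nonneg hq0 hItop)).symm
    _ ≤ ∫⁻ y, ∫⁻ z, ENNReal.ofReal (g z) ^ p ∂(κ y) ∂μ := lintegral_mono hpt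
    _ = ∫⁻ z, ENNReal.ofReal (g z) ^ p ∂(μ.bind fun x => κ x) :=
        (Measure.lintegral_bind κ.measurable.aemeasurable (by fun_prop)).symm
    _ = I := by rw [hinv]
end

section
/- Let H be a real separable Hilbert space with its Borel σ-algebra, κ a Markov kernel from H to H, and μ a probability measure on H invariant for κ. Let C > 0, θ > 0, and assume the Harnack inequality for indicator functions with p = 2: for every Borel set M and all x, y ∈ H, ( κ(x, M) )² ≤ κ(y, M) · exp( 2C ‖x − y‖^θ ). Then for every x ∈ H and every Borel set M, ( κ(x, M) )² · ∫_H exp( −2C ‖x − y‖^θ ) μ(dy) ≤ μ(M); in particular, for every x ∈ H the measure κ(x,·) is absolutely continuous with respect to μ. -/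
open Real MeasureTheory ProbabilityTheory ENNReal

theorem harnack_abs_continuity
    {H : Type*} [NormedAddCommGroup H] [InnerProductSpace ℝ H] [CompleteSpace H]
    [TopologicalSpace.SeparableSpace H] [MeasurableSpace H] [BorelSpace H]
    (κ : Kernel H H) [IsMarkovKernel κ]
    (μ : Measure H) [IsProbabilityMeasure μ]
    (hinv : μ.bind (fun x => κ x) = μ)
    (C θ : ℝ) (hC : 0 < C) (hθ : 0 < θ)
    (harnack : ∀ M : Set H, MeasurableSet M → ∀ x y : H,
      (κ x M) ^ 2 ≤ κ y M * ENNReal.ofReal (Real.exp (2 * C * ‖x - y‖ ^ θ))) :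
    (∀ x : H, ∀ M : Set H, MeasurableSet M →
      (κ x M) ^ 2 * ∫⁻ y, ENNReal.ofReal (Real.exp (-(2 * C) * ‖x - y‖ ^ θ)) ∂μ
        ≤ μ M) ∧
    (∀ x : H, κ x ≪ μ) := by
  have hmeas (x : H) :
      Measurable fun y => ENNReal.ofReal (Real.exp (-(2 * C) * ‖x - y‖ ^ θ)) := by
    have hsub : Measurable fun y : H => ‖x - y‖ := by
      have : Continuous fun y : H => ‖x - y‖ := by fun_prop
      exact this.measurable
    exact ((hsub.pow_const θ).const_mul _).exp.ennreal_ofReal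
  have hbound : ∀ x : H, ∀ M : Set H, MeasurableSet M →
      (κ x M) ^ 2 * ∫⁻ y, ENNReal.ofReal (Real.exp (-(2 * C) * ‖x - y‖ ^ θ)) ∂μ
        ≤ μ M := by
    intro x M hM
    calc _ = ∫⁻ y, (κ x M) ^ 2 * ENNReal.ofReal (Real.exp (-(2 * C) * ‖x - y‖ ^ θ)) ∂μ :=
          (lintegral_const_mul _ (hmeas x)).symm
      _ ≤ ∫⁻ y, κ y M ∂μ := by
          refine lintegral_mono fun y => (mul_le_mul_left (harnack M hM x y) _).trans_eq ?_
          rw [mul_assoc, ← ENNReal.ofReal_mul (Real.exp_pos _).le, ← Real.exp_add, neg_mul,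
            add_neg_cancel, Real.exp_zero, ENNReal.ofReal_one, mul_one]
      _ = μ M := by
          rw [← Measure.bind_apply hM κ.measurable.aemeasurable, hinv]
  refine ⟨hbound, fun x => Measure.AbsolutelyContinuous.mk fun M hM hμM => ?_⟩
  have hpos : 0 < ∫⁻ y, ENNReal.ofReal (Real.exp (-(2 * C) * ‖x - y‖ ^ θ)) ∂μ := by
    rw [lintegral_pos_iff_support (hmeas x), Function.support_eq_univ fun y =>
      (ENNReal.ofReal_pos.2 (Real.exp_pos _)).ne', measure_univ]
    exact one_pos
  have hzero := hbound x M hM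
  rw [hμM, nonpos_iff_eq_zero, mul_eq_zero, or_iff_left hpos.ne'] at hzero
  exact pow_eq_zero_iff two_ne_zero |>.1 hzero
end

section
/- Let H be a real separable Hilbert space with its Borel σ-algebra, κ a Markov kernel from H to H, and μ a probability measure on H invariant for κ and with full topological support (every nonempty open subset of H has positive μ-measure). Let p > 1, c > 0, θ > 0, and assume the Harnack inequality for indicator functions: for every Borel set M and all x, y ∈ H, ( κ(x, M) )^p ≤ κ(y, M) · exp( c ‖x − y‖^θ ). Then κ is irreducible: for every nonempty open set M ⊆ H and every x ∈ H, κ(x, M) > 0. -/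
open Real MeasureTheory ProbabilityTheory ENNReal

theorem harnack_irreducibility
    {H : Type*} [NormedAddCommGroup H] [InnerProductSpace ℝ H] [CompleteSpace H]
    [TopologicalSpace.SeparableSpace H] [MeasurableSpace H] [BorelSpace H]
    (κ : Kernel H H) [IsMarkovKernel κ]
    (μ : Measure H) [IsProbabilityMeasure μ]
    (hinv : μ.bind (fun x => κ x) = μ)
    (hsupp : ∀ U : Set H, IsOpen U → U.Nonempty → 0 < μ U)
    (p c θ : ℝ) (hp : 1 < p) (hc : 0 < c) (hθ : 0 < θ)
    (harnack : ∀ M : Set H, MeasurableSet M → ∀ x y : H,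
      (κ x M) ^ p ≤ κ y M * ENNReal.ofReal (Real.exp (c * ‖x - y‖ ^ θ))) :
    ∀ M : Set H, IsOpen M → M.Nonempty → ∀ x : H, 0 < κ x M := by
  intro M hM hne x
  refine pos_iff_ne_zero.mpr fun hx => ?_
  have hzero : ∀ y, κ y M = 0 := fun y => by
    have h := harnack M hM.measurableSet y x
    rw [hx, zero_mul, nonpos_iff_eq_zero] at h
    exact (ENNReal.rpow_eq_zero_iff_of_pos (by linarith)).mp h
  have hμ : μ M = 0 := by
    rw [← hinv, Measure.bind_apply hM.measurableSet κ.measurable.aemeasurable]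
    simp [hzero]
  exact (hsupp M hM hne).ne' hμ
end

section
/- Let H be a real separable Hilbert space with its Borel σ-algebra, κ a Markov kernel from H to H, and μ a probability measure on H invariant for κ with μ(B(0,1)) > 0, where B(0,1) := {y ∈ H : ‖y‖ ≤ 1}. Let c > 0, θ > 0, and let f : H → [0,∞) be measurable with ∫ f² dμ ≤ 1. Assume the Harnack inequality with p = 2: for all x, y ∈ H, (κf(x))² ≤ κ(f²)(y) · exp( c ‖x − y‖^θ ). Then for every x ∈ H, (κf(x))² ≤ (1 / μ(B(0,1))) · exp( c (‖x‖ + 1)^θ ). -/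
open Real MeasureTheory ProbabilityTheory ENNReal

theorem harnack_pointwise_semigroup_bound
    {H : Type*} [NormedAddCommGroup H] [InnerProductSpace ℝ H] [CompleteSpace H]
    [TopologicalSpace.SeparableSpace H] [MeasurableSpace H] [BorelSpace H]
    (κ : Kernel H H) [IsMarkovKernel κ]
    (μ : Measure H) [IsProbabilityMeasure μ]
    (hinv : μ.bind (fun x => κ x) = μ)
    (hball : 0 < μ (Metric.closedBall (0 : H) 1))
    (c θ : ℝ) (hc : 0 < c) (hθ : 0 < θ)
    (f : H → ℝ) (hf : Measurable f) (hf0 : ∀ y, 0 ≤ f y)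
    (hf2 : ∫⁻ y, ENNReal.ofReal ((f y) ^ 2) ∂μ ≤ 1)
    (harnack : ∀ x y : H,
      (∫⁻ z, ENNReal.ofReal (f z) ∂(κ x)) ^ 2
        ≤ (∫⁻ z, ENNReal.ofReal ((f z) ^ 2) ∂(κ y))
            * ENNReal.ofReal (Real.exp (c * ‖x - y‖ ^ θ))) :
    ∀ x : H,
      (∫⁻ z, ENNReal.ofReal (f z) ∂(κ x)) ^ 2
        ≤ (1 / μ (Metric.closedBall (0 : H) 1))
            * ENNReal.ofReal (Real.exp (c * (‖x‖ + 1) ^ θ)) := by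
  intro x
  set E : ℝ≥0∞ := ENNReal.ofReal (Real.exp (c * (‖x‖ + 1) ^ θ))
  have hmeas : Measurable fun y => ENNReal.ofReal ((f y) ^ 2) :=
    (hf.pow_const 2).ennreal_ofReal
  have hsemigroup :
      ∫⁻ y, ∫⁻ z, ENNReal.ofReal ((f z) ^ 2) ∂(κ y) ∂μ ≤ 1 := by
    rw [← Measure.lintegral_bind κ.measurable.aemeasurable hmeas.aemeasurable, hinv]
    exact hf2
  have hbound : ∀ y ∈ Metric.closedBall (0 : H) 1,
      (∫⁻ z, ENNReal.ofReal (f z) ∂(κ x)) ^ 2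
        ≤ (∫⁻ z, ENNReal.ofReal ((f z) ^ 2) ∂(κ y)) * E := by
    intro y hy
    have hdist : ‖x - y‖ ≤ ‖x‖ + 1 :=
      (norm_sub_le x y).trans (by gcongr; exact mem_closedBall_zero_iff.mp hy)
    refine (harnack x y).trans ?_
    unfold E
    gcongr
  rw [one_div, mul_comm, ← div_eq_mul_inv,
    ENNReal.le_div_iff_mul_le (Or.inl hball.ne') (Or.inl (measure_ne_top μ _))]
  calc
    _ = ∫⁻ _ in Metric.closedBall (0 : H) 1,
          (∫⁻ z, ENNReal.ofReal (f z) ∂(κ x)) ^ 2 ∂μ := (setLIntegral_const _ _).symm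
    _ ≤ ∫⁻ y in Metric.closedBall (0 : H) 1,
          (∫⁻ z, ENNReal.ofReal ((f z) ^ 2) ∂(κ y)) * E ∂μ :=
        setLIntegral_mono' measurableSet_closedBall hbound
    _ ≤ ∫⁻ y, (∫⁻ z, ENNReal.ofReal ((f z) ^ 2) ∂(κ y)) * E ∂μ :=
        setLIntegral_le_lintegral _ _
    _ = (∫⁻ y, ∫⁻ z, ENNReal.ofReal ((f z) ^ 2) ∂(κ y) ∂μ) * E :=
        lintegral_mul_const' _ _ ENNReal.ofReal_ne_top
    _ ≤ E := mul_le_of_le_one_left' hsemigroup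
end
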